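/- (Pre-dual form of Grothendieck's theorem for $L^p$-lattices.) There exists a universal constant $K > 0$ with the following property: for all measure spaces $(\Omega,\Sigma,\mu)$, $(\Omega',\Sigma',\nu)$, all $1 \le u, v \le \infty$, and all finite families $f_1,\dots,f_n \in L^u(\mu)$, $g_1,\dots,g_n \in L^v(\nu)$, the projective tensor seminorm of $z = \sum_{i=1}^n f_i \otimes g_i$ in the algebraic tensor product $L^u(\mu) \otimes L^v(\nu)$ satisfies $\pi(z) \le K\, \big\|(\sum_{i=1}^n |f_i|^2)^{1/2}\big\|_{L^u(\mu)} \cdot \big\|(\sum_{i=1}^n |g_i|^2)^{1/2}\big\|_{L^v(\nu)}$. -/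

import Mathlib

open MeasureTheory ENNReal TensorProduct

section ProjectiveBound

variable {X Y X' Y' : Type*}
  [NormedAddCommGroup X] [NormedSpace ℝ X] [NormedAddCommGroup Y] [NormedSpace ℝ Y]
  [NormedAddCommGroup X'] [NormedSpace ℝ X'] [NormedAddCommGroup Y'] [NormedSpace ℝ Y']

/-- `z` has a finite representation `∑ⱼ xⱼ ⊗ yⱼ` with `∑ⱼ ‖xⱼ‖ ‖yⱼ‖ ≤ c`. -/
def HasProjectiveBound (z : X ⊗[ℝ] Y) (c : ℝ) : Prop :=
  ∃ (m : ℕ) (x : Fin m → X) (y : Fin m → Y),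
    ∑ i, x i ⊗ₜ[ℝ] y i = z ∧ ∑ i, ‖x i‖ * ‖y i‖ ≤ c

theorem HasProjectiveBound.of_sum {σ : Type*} [Fintype σ] (x : σ → X) (y : σ → Y) {c : ℝ}
    (hc : ∑ i, ‖x i‖ * ‖y i‖ ≤ c) : HasProjectiveBound (∑ i, x i ⊗ₜ[ℝ] y i) c := by
  let e := (Fintype.equivFin σ).symm
  refine ⟨Fintype.card σ, x ∘ e, y ∘ e, ?_, ?_⟩
  · exact e.sum_comp fun i => x i ⊗ₜ[ℝ] y i
  · exact (e.sum_comp fun i => ‖x i‖ * ‖y i‖).trans_le hc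

theorem HasProjectiveBound.mono {z : X ⊗[ℝ] Y} {c d : ℝ} (h : HasProjectiveBound z c)
    (hcd : c ≤ d) : HasProjectiveBound z d := by
  obtain ⟨m, x, y, hz, hc⟩ := h
  exact ⟨m, x, y, hz, hc.trans hcd⟩

theorem HasProjectiveBound.add {z w : X ⊗[ℝ] Y} {c d : ℝ} (hz : HasProjectiveBound z c)
    (hw : HasProjectiveBound w d) : HasProjectiveBound (z + w) (c + d) := by
  obtain ⟨m, x, y, rfl, hc⟩ := hz
  obtain ⟨m', x', y', rfl, hd⟩ := hw
  have h := HasProjectiveBound.of_sum (Sum.elim x x') (Sum.elim y y') (c := c + d)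
    (by simpa using add_le_add hc hd)
  simpa using h

theorem HasProjectiveBound.map {z : X ⊗[ℝ] Y} {a b c : ℝ} (hz : HasProjectiveBound z c)
    (ha : 0 ≤ a) (hb : 0 ≤ b) (S : X →ₗ[ℝ] X') (T : Y →ₗ[ℝ] Y')
    (hS : ∀ x, ‖S x‖ ≤ a * ‖x‖) (hT : ∀ y, ‖T y‖ ≤ b * ‖y‖) :
    HasProjectiveBound (TensorProduct.map S T z) (a * b * c) := by
  obtain ⟨m, x, y, rfl, hc⟩ := hz
  refine ⟨m, S ∘ x, T ∘ y, by simp, ?_⟩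
  calc ∑ i, ‖S (x i)‖ * ‖T (y i)‖ ≤ ∑ i, (a * b) * (‖x i‖ * ‖y i‖) := by
        refine Finset.sum_le_sum fun i _ => ?_
        calc ‖S (x i)‖ * ‖T (y i)‖ ≤ (a * ‖x i‖) * (b * ‖y i‖) := by
              gcongr
              exacts [hS _, hT _]
          _ = _ := by ring
    _ ≤ a * b * c := by
        rw [← Finset.mul_sum]
        gcongr

theorem HasProjectiveBound.sInf_le {z : X ⊗[ℝ] Y} {c : ℝ} (h : HasProjectiveBound z c) :
    sInf {c : ℝ | ∃ (m : ℕ) (x : Fin m → X) (y : Fin m → Y),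
      ∑ i, x i ⊗ₜ[ℝ] y i = z ∧ c = ∑ i, ‖x i‖ * ‖y i‖} ≤ c := by
  obtain ⟨m, x, y, hz, hc⟩ := h
  refine le_trans (csInf_le ?_ ⟨m, x, y, hz, rfl⟩) hc
  refine ⟨0, ?_⟩
  rintro _ ⟨m, x, y, -, rfl⟩
  positivity

end ProjectiveBound

section Rademacher

variable {σ : Type*}

/-- The `k`-th Rademacher function on the cube of signs. -/
def rademacher (k : σ) (ε : σ → ℤˣ) : ℝ := ((ε k : ℤ) : ℝ)

theorem rademacher_mul_self (k : σ) (ε : σ → ℤˣ) : rademacher k ε * rademacher k ε = 1 := by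
  unfold rademacher
  rcases Int.units_eq_one_or (ε k) with h | h <;> simp [h]

theorem rademacher_mulSingle_mul_self [DecidableEq σ] (k : σ) (ε : σ → ℤˣ) :
    rademacher k (Pi.mulSingle k (-1) * ε) = -rademacher k ε := by
  simp [rademacher]

theorem rademacher_mulSingle_mul_of_ne [DecidableEq σ] {k l : σ} (h : l ≠ k) (ε : σ → ℤˣ) :
    rademacher l (Pi.mulSingle k (-1) * ε) = rademacher l ε := by
  simp [rademacher, Pi.mulSingle_eq_of_ne h]

variable [Fintype σ] [DecidableEq σ]

theorem sum_rademacher_mul_eq_zero (k : σ) (h : (σ → ℤˣ) → ℝ)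
    (hh : ∀ ε, h (Pi.mulSingle k (-1) * ε) = h ε) : ∑ ε, rademacher k ε * h ε = 0 := by
  have := Equiv.sum_comp (Equiv.mulLeft (Pi.mulSingle k (-1) : σ → ℤˣ))
    fun ε => rademacher k ε * h ε
  simp only [Equiv.coe_mulLeft, rademacher_mulSingle_mul_self, hh, neg_mul,
    Finset.sum_neg_distrib] at this
  linarith

theorem sum_rademacher_mul_rademacher (k l : σ) :
    ∑ ε, rademacher k ε * rademacher l ε =
      if k = l then (Fintype.card (σ → ℤˣ) : ℝ) else 0 := by
  split_ifs with h
  · subst h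
    simp [rademacher_mul_self]
  · exact sum_rademacher_mul_eq_zero k _
      fun ε => rademacher_mulSingle_mul_of_ne (fun h' => h h'.symm) ε

/-- Second and fourth moments of a Rademacher sum. -/
theorem rademacher_moments (a : σ → ℝ) (s : Finset σ) :
    ∑ ε, (∑ k ∈ s, rademacher k ε * a k) ^ 2 =
        Fintype.card (σ → ℤˣ) * ∑ k ∈ s, a k ^ 2 ∧
      ∑ ε, (∑ k ∈ s, rademacher k ε * a k) ^ 4 ≤
        3 * Fintype.card (σ → ℤˣ) * (∑ k ∈ s, a k ^ 2) ^ 2 := by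
  induction s using Finset.induction_on with
  | empty => simp
  | insert k s hk ih =>
    obtain ⟨ih2, ih4⟩ := ih
    set S : (σ → ℤˣ) → ℝ := fun ε => ∑ k ∈ s, rademacher k ε * a k
    set Q := ∑ k ∈ s, a k ^ 2 with hQ
    change ∑ ε, S ε ^ 2 = _ at ih2
    change ∑ ε, S ε ^ 4 ≤ _ at ih4
    have hflip (ε) : S (Pi.mulSingle k (-1) * ε) = S ε := by
      refine Finset.sum_congr rfl fun l hl => ?_
      rw [rademacher_mulSingle_mul_of_ne (ne_of_mem_of_not_mem hl hk)]
    have h1 : ∑ ε, rademacher k ε * (2 * a k * S ε) = 0 :=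
      sum_rademacher_mul_eq_zero k _ fun ε => by rw [hflip]
    have h3 : ∑ ε, rademacher k ε * (4 * a k * S ε ^ 3 + 4 * a k ^ 3 * S ε) = 0 :=
      sum_rademacher_mul_eq_zero k _ fun ε => by rw [hflip]
    have e2 (ε) : (rademacher k ε * a k + S ε) ^ 2 =
        rademacher k ε * (2 * a k * S ε) + S ε ^ 2 + a k ^ 2 := by
      linear_combination a k ^ 2 * rademacher_mul_self k ε
    have e4 (ε) : (rademacher k ε * a k + S ε) ^ 4 =
        rademacher k ε * (4 * a k * S ε ^ 3 + 4 * a k ^ 3 * S ε)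
          + S ε ^ 4 + 6 * a k ^ 2 * S ε ^ 2 + a k ^ 4 := by
      linear_combination (a k ^ 4 * (rademacher k ε * rademacher k ε + 1)
        + 4 * a k ^ 3 * S ε * rademacher k ε + 6 * a k ^ 2 * S ε ^ 2) * rademacher_mul_self k ε
    simp only [Finset.sum_insert hk, ← hQ]
    change ∑ ε, (rademacher k ε * a k + S ε) ^ 2 = _ ∧
      ∑ ε, (rademacher k ε * a k + S ε) ^ 4 ≤ _
    simp only [e2, e4, Finset.sum_add_distrib, h1, h3, ← Finset.mul_sum, ih2,
      Finset.sum_const, Finset.card_univ, nsmul_eq_mul]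
    refine ⟨by ring, ?_⟩
    have : 0 ≤ (Fintype.card (σ → ℤˣ) : ℝ) * a k ^ 4 := by positivity
    linarith

theorem sum_rademacher_sum_tmul {X Y : Type*} [AddCommGroup X] [Module ℝ X]
    [AddCommGroup Y] [Module ℝ Y] (x : σ → X) (y : σ → Y) :
    ∑ ε, (∑ k, rademacher k ε • x k) ⊗ₜ[ℝ] (∑ k, rademacher k ε • y k) =
      (Fintype.card (σ → ℤˣ) : ℝ) • ∑ k, x k ⊗ₜ[ℝ] y k := by
  simp only [TensorProduct.sum_tmul, TensorProduct.tmul_sum, TensorProduct.smul_tmul_smul]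
  rw [Finset.sum_comm, Finset.smul_sum]
  refine Finset.sum_congr rfl fun k _ => ?_
  rw [Finset.sum_comm]
  simp only [← Finset.sum_smul, sum_rademacher_mul_rademacher, ite_smul, zero_smul,
    Finset.sum_ite_eq', Finset.mem_univ, if_true]

end Rademacher

section Truncation

/-- Truncation of `t` to the interval `[-L, L]`. -/
def truncate (L t : ℝ) : ℝ := max (-L) (min L t)

theorem abs_truncate_le {L : ℝ} (hL : 0 ≤ L) (t : ℝ) : |truncate L t| ≤ L :=
  abs_le.2 ⟨le_max_left _ _, max_le (by linarith) (min_le_left _ _)⟩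

theorem truncate_sq_le {L : ℝ} (hL : 0 ≤ L) (t : ℝ) : truncate L t ^ 2 ≤ t ^ 2 := by
  unfold truncate
  rcases le_total L t with h | h
  · rw [min_eq_left h, max_eq_right (by linarith)]
    nlinarith
  · rw [min_eq_right h]
    rcases le_total (-L) t with h' | h'
    · rw [max_eq_right h']
    · rw [max_eq_left h']
      nlinarith

theorem sub_truncate_sq_le {L : ℝ} (hL : 0 < L) (t : ℝ) :
    (t - truncate L t) ^ 2 ≤ t ^ 4 / (16 * L ^ 2) := by
  have key : |t - truncate L t| ≤ t ^ 2 / (4 * L) := by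
    rw [le_div_iff₀ (by positivity)]
    unfold truncate
    rcases le_total L t with h | h
    · rw [min_eq_left h, max_eq_right (by linarith), abs_of_nonneg (by linarith)]
      nlinarith [sq_nonneg (t - 2 * L)]
    · rw [min_eq_right h]
      rcases le_total (-L) t with h' | h'
      · rw [max_eq_right h']
        simp [sq_nonneg]
      · rw [max_eq_left h', abs_of_nonpos (by linarith)]
        nlinarith [sq_nonneg (t + 2 * L)]
  calc (t - truncate L t) ^ 2 = |t - truncate L t| ^ 2 := (sq_abs _).symm
    _ ≤ (t ^ 2 / (4 * L)) ^ 2 := by gcongr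
    _ = t ^ 4 / (16 * L ^ 2) := by ring

/-- A Rademacher average splits into a uniformly bounded part and a part which is small in
mean square. -/
theorem exists_rademacher_splitting {σ ι : Type*} [Fintype σ] [DecidableEq σ] [Fintype ι]
    (x : σ → ι → ℝ) {a : ℝ} (ha : 0 < a) (hx : ∀ i, ∑ k, x k i ^ 2 ≤ a ^ 2) {w : ℝ}
    (hw : 0 < w) (hw2 : w ^ 2 * Fintype.card (σ → ℤˣ) = 1) :
    ∃ T R : (σ → ℤˣ) → ι → ℝ,
      (∀ ε, w • ∑ k, rademacher k ε • x k = T ε + R ε) ∧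
      (∀ ε, ‖T ε‖ ≤ 2 * a * w) ∧
      (∀ i, ∑ ε, T ε i ^ 2 ≤ a ^ 2) ∧
      (∀ i, ∑ ε, R ε i ^ 2 ≤ (a / 4) ^ 2) ∧
      (∀ i, ∑ ε, (T ε i + R ε i) ^ 2 ≤ a ^ 2) := by
  set Z : (σ → ℤˣ) → ι → ℝ := fun ε i => w * ∑ k, rademacher k ε * x k i with hZ
  have hZ2 (i) : ∑ ε, Z ε i ^ 2 ≤ a ^ 2 := by
    simp only [hZ, mul_pow]
    rw [← Finset.mul_sum, (rademacher_moments (fun k => x k i) Finset.univ).1, ← mul_assoc,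
      hw2, one_mul]
    exact hx i
  have hZ4 (i) : ∑ ε, Z ε i ^ 4 ≤ 3 * w ^ 2 * a ^ 4 := by
    simp only [hZ, mul_pow]
    rw [← Finset.mul_sum]
    calc w ^ 4 * ∑ ε, (∑ k, rademacher k ε * x k i) ^ 4
        ≤ w ^ 4 * (3 * Fintype.card (σ → ℤˣ) * (∑ k, x k i ^ 2) ^ 2) := by
          gcongr
          exact (rademacher_moments (fun k => x k i) Finset.univ).2
      _ = 3 * w ^ 2 * (∑ k, x k i ^ 2) ^ 2 := by
          linear_combination 3 * w ^ 2 * (∑ k, x k i ^ 2) ^ 2 * hw2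
      _ ≤ 3 * w ^ 2 * (a ^ 2) ^ 2 := by
          gcongr
          exact hx i
      _ = _ := by ring
  have hL : 0 < 2 * a * w := by positivity
  refine ⟨fun ε i => truncate (2 * a * w) (Z ε i),
    fun ε i => Z ε i - truncate (2 * a * w) (Z ε i), ?_, ?_, ?_, ?_, ?_⟩
  · intro ε
    ext i
    simp [hZ]
  · intro ε
    exact (pi_norm_le_iff_of_nonneg hL.le).2 fun i => abs_truncate_le hL.le _
  · intro i
    exact (Finset.sum_le_sum fun ε _ => truncate_sq_le hL.le _).trans (hZ2 i)
  · intro i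
    calc ∑ ε, (Z ε i - truncate (2 * a * w) (Z ε i)) ^ 2
        ≤ ∑ ε, Z ε i ^ 4 / (16 * (2 * a * w) ^ 2) :=
          Finset.sum_le_sum fun ε _ => sub_truncate_sq_le hL _
      _ = (∑ ε, Z ε i ^ 4) / (16 * (2 * a * w) ^ 2) := (Finset.sum_div _ _ _).symm
      _ ≤ (3 * w ^ 2 * a ^ 4) / (16 * (2 * a * w) ^ 2) := by
          gcongr
          exact hZ4 i
      _ = 3 / 64 * a ^ 2 := by field_simp; norm_num
      _ ≤ (a / 4) ^ 2 := by nlinarith [sq_nonneg a]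
  · intro i
    simpa using hZ2 i

end Truncation

section FiniteGrothendieck

variable {ι κ : Type*} [Fintype ι] [Fintype κ]

theorem abs_le_of_sum_sq_le {σ : Type*} [Fintype σ] {t : σ → ℝ} {a : ℝ} (ha : 0 ≤ a)
    (h : ∑ k, t k ^ 2 ≤ a ^ 2) (k : σ) : |t k| ≤ a :=
  abs_le_of_sq_le_sq ((Finset.single_le_sum (f := fun k => t k ^ 2)
    (fun _ _ => sq_nonneg _) (Finset.mem_univ k)).trans h) ha

theorem hasProjectiveBound_card_mul_card {σ : Type*} [Fintype σ] (x : σ → ι → ℝ)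
    (y : σ → κ → ℝ) {a b : ℝ} (ha : 0 < a) (hb : 0 < b) (hx : ∀ i, ∑ k, x k i ^ 2 ≤ a ^ 2)
    (hy : ∀ j, ∑ k, y k j ^ 2 ≤ b ^ 2) :
    HasProjectiveBound (∑ k, x k ⊗ₜ[ℝ] y k)
      (a * b * (Fintype.card ι * Fintype.card κ)) := by
  classical
  have hz : ∑ k, x k ⊗ₜ[ℝ] y k = ∑ p : ι × κ,
      ((∑ k, x k p.1 * y k p.2) • Pi.single p.1 (1 : ℝ)) ⊗ₜ[ℝ] Pi.single p.2 (1 : ℝ) := by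
    have hex (v : ι → ℝ) : v = ∑ i, v i • Pi.single i (1 : ℝ) := pi_eq_sum_univ' v
    have hey (v : κ → ℝ) : v = ∑ i, v i • Pi.single i (1 : ℝ) := pi_eq_sum_univ' v
    have hk (k) : x k ⊗ₜ[ℝ] y k = ∑ p : ι × κ,
        (x k p.1 * y k p.2) • (Pi.single p.1 (1 : ℝ) ⊗ₜ[ℝ] Pi.single p.2 (1 : ℝ)) := by
      conv_lhs => rw [hex (x k), hey (y k)]
      simp only [TensorProduct.sum_tmul, TensorProduct.tmul_sum, TensorProduct.smul_tmul_smul,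
        Fintype.sum_prod_type]
      exact Finset.sum_comm
    simp only [hk, TensorProduct.smul_tmul', Finset.sum_smul, TensorProduct.sum_tmul]
    exact Finset.sum_comm
  rw [hz]
  refine HasProjectiveBound.of_sum _ _ ?_
  calc ∑ p : ι × κ, ‖(∑ k, x k p.1 * y k p.2) • (Pi.single p.1 (1 : ℝ) : ι → ℝ)‖ *
        ‖(Pi.single p.2 (1 : ℝ) : κ → ℝ)‖ ≤ ∑ p : ι × κ, a * b := by
        refine Finset.sum_le_sum fun p _ => ?_
        rw [norm_smul, Pi.norm_single (G := fun _ => ℝ), Pi.norm_single (G := fun _ => ℝ), norm_one,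
          mul_one, mul_one]
        refine abs_le_of_sq_le_sq ?_ (by positivity)
        calc (∑ k, x k p.1 * y k p.2) ^ 2
            ≤ (∑ k, x k p.1 ^ 2) * ∑ k, y k p.2 ^ 2 :=
              Finset.sum_mul_sq_le_sq_mul_sq _ _ _
          _ ≤ a ^ 2 * b ^ 2 := by
              gcongr
              exacts [hx _, hy _]
          _ = (a * b) ^ 2 := by ring
    _ = a * b * (Fintype.card ι * Fintype.card κ) := by
        simp; ring

/-- The rank-dependent term is halved with each use of the splitting. -/
theorem hasProjectiveBound_add_div_two_pow (N : ℕ) : ∀ {σ : Type} [Fintype σ]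
    (x : σ → ι → ℝ) (y : σ → κ → ℝ) {a b : ℝ}, 0 < a → 0 < b →
    (∀ i, ∑ k, x k i ^ 2 ≤ a ^ 2) → (∀ j, ∑ k, y k j ^ 2 ≤ b ^ 2) →
    HasProjectiveBound (∑ k, x k ⊗ₜ[ℝ] y k)
      (a * b * (8 + Fintype.card ι * Fintype.card κ / 2 ^ N)) := by
  induction N with
  | zero =>
    intro σ _ x y a b ha hb hx hy
    refine (hasProjectiveBound_card_mul_card x y ha hb hx hy).mono ?_
    gcongr
    simp
  | succ N ih =>
    intro σ _ x y a b ha hb hx hy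
    classical
    have hm : (0 : ℝ) < Fintype.card (σ → ℤˣ) := by exact_mod_cast Fintype.card_pos
    obtain ⟨w, hw, hw2⟩ : ∃ w : ℝ, 0 < w ∧ w ^ 2 * Fintype.card (σ → ℤˣ) = 1 := by
      refine ⟨(√(Fintype.card (σ → ℤˣ) : ℝ))⁻¹, by positivity, ?_⟩
      rw [inv_pow, Real.sq_sqrt hm.le, inv_mul_cancel₀ hm.ne']
    obtain ⟨T, R, hTR, hT, hT2, hR2, -⟩ := exists_rademacher_splitting x ha hx hw hw2
    obtain ⟨T', R', hTR', hT', -, hR2', hY2⟩ := exists_rademacher_splitting y hb hy hw hw2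
    have hz : ∑ k, x k ⊗ₜ[ℝ] y k = ∑ ε, T ε ⊗ₜ[ℝ] T' ε + ∑ ε, T ε ⊗ₜ[ℝ] R' ε +
        ∑ ε, R ε ⊗ₜ[ℝ] (T' ε + R' ε) := by
      calc ∑ k, x k ⊗ₜ[ℝ] y k
          = ∑ ε, (w • ∑ k, rademacher k ε • x k) ⊗ₜ[ℝ] (w • ∑ k, rademacher k ε • y k) := by
            simp only [TensorProduct.smul_tmul_smul]
            rw [← Finset.smul_sum, sum_rademacher_sum_tmul, smul_smul, ← sq, hw2, one_smul]
        _ = _ := by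
            simp only [hTR, hTR', ← Finset.sum_add_distrib]
            refine Finset.sum_congr rfl fun ε _ => ?_
            rw [TensorProduct.add_tmul, TensorProduct.tmul_add]
    have hTT : HasProjectiveBound (∑ ε, T ε ⊗ₜ[ℝ] T' ε) (4 * (a * b)) := by
      refine HasProjectiveBound.of_sum _ _ ?_
      calc ∑ ε, ‖T ε‖ * ‖T' ε‖ ≤ ∑ ε : σ → ℤˣ, (2 * a * w) * (2 * b * w) := by
            gcongr with ε
            exacts [hT ε, hT' ε]
        _ = 4 * (a * b) := by
            rw [Finset.sum_const, Finset.card_univ, nsmul_eq_mul]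
            linear_combination 4 * a * b * hw2
    rw [hz]
    refine ((hTT.add (ih T R' ha (by positivity : 0 < b / 4) hT2 hR2')).add
      (ih R (fun ε => T' ε + R' ε) (by positivity : 0 < a / 4) hb hR2 hY2)).mono ?_
    rw [pow_succ]
    apply le_of_eq
    field_simp
    ring

/-- **Grothendieck's theorem** for finite-dimensional `ℓ^∞` spaces. -/
theorem hasProjectiveBound_of_sum_sq_le {σ : Type} [Fintype σ] (x : σ → ι → ℝ)
    (y : σ → κ → ℝ) {a b : ℝ} (ha : 0 < a) (hb : 0 < b) (hx : ∀ i, ∑ k, x k i ^ 2 ≤ a ^ 2)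
    (hy : ∀ j, ∑ k, y k j ^ 2 ≤ b ^ 2) :
    HasProjectiveBound (∑ k, x k ⊗ₜ[ℝ] y k) (9 * (a * b)) := by
  obtain ⟨N, hN⟩ := pow_unbounded_of_one_lt
    ((Fintype.card ι : ℝ) * Fintype.card κ) one_lt_two
  refine (hasProjectiveBound_add_div_two_pow N x y ha hb hx hy).mono ?_
  rw [mul_comm 9]
  gcongr
  have : (Fintype.card ι : ℝ) * Fintype.card κ / 2 ^ N ≤ 1 :=
    (div_le_one (by positivity)).2 hN.le
  linarith

end FiniteGrothendieck

section SquareFunction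

variable {Ω : Type*} [MeasurableSpace Ω] {μ : Measure Ω} {u : ℝ≥0∞} {n : ℕ}

/-- The square function `(∑ᵢ |fᵢ|²)^(1/2)` of a finite family. -/
noncomputable def squareFunction (f : Fin n → Lp ℝ u μ) (ω : Ω) : ℝ :=
  (∑ i, |f i ω| ^ (2 : ℝ)) ^ (1 / (2 : ℝ))

theorem squareFunction_eq_sqrt (f : Fin n → Lp ℝ u μ) (ω : Ω) :
    squareFunction f ω = √(∑ i, f i ω ^ 2) := by
  simp [squareFunction, Real.sqrt_eq_rpow]

theorem squareFunction_nonneg (f : Fin n → Lp ℝ u μ) (ω : Ω) : 0 ≤ squareFunction f ω := by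
  rw [squareFunction_eq_sqrt]
  positivity

theorem squareFunction_sq (f : Fin n → Lp ℝ u μ) (ω : Ω) :
    squareFunction f ω ^ 2 = ∑ i, f i ω ^ 2 := by
  rw [squareFunction_eq_sqrt, Real.sq_sqrt (by positivity)]

theorem abs_le_squareFunction (f : Fin n → Lp ℝ u μ) (i : Fin n) (ω : Ω) :
    |f i ω| ≤ squareFunction f ω :=
  abs_le_of_sum_sq_le (squareFunction_nonneg f ω) (squareFunction_sq f ω).ge i

theorem measurable_squareFunction (f : Fin n → Lp ℝ u μ) : Measurable (squareFunction f) := by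
  have h (i) : Measurable (f i) := (Lp.stronglyMeasurable (f i)).measurable
  unfold squareFunction
  fun_prop

theorem memLp_squareFunction (f : Fin n → Lp ℝ u μ) : MemLp (squareFunction f) u μ := by
  have h : MemLp (fun ω => ∑ i, |f i ω|) u μ :=
    memLp_finsetSum _ fun i _ => (Lp.memLp (f i)).abs
  refine h.mono (measurable_squareFunction f).aestronglyMeasurable (ae_of_all _ fun ω => ?_)
  have h0 : 0 ≤ ∑ i, |f i ω| := Finset.sum_nonneg fun _ _ => abs_nonneg _
  rw [Real.norm_of_nonneg (squareFunction_nonneg f ω), Real.norm_of_nonneg h0]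
  refine le_of_sq_le_sq ?_ h0
  rw [squareFunction_sq]
  simpa using Finset.sum_sq_le_sq_sum_of_nonneg (s := Finset.univ) (f := fun i => |f i ω|)
    fun i _ => abs_nonneg _

/-- Multiplication of a fixed `L^u` function by functions factoring through `c`. -/
theorem exists_linearMap_mul_comp [Fact (1 ≤ u)] {ι : Type*} [Fintype ι] [MeasurableSpace ι]
    [DiscreteMeasurableSpace ι] {F : Ω → ℝ} (hF : MemLp F u μ) {c : Ω → ι}
    (hc : Measurable c) :
    ∃ S : (ι → ℝ) →ₗ[ℝ] Lp ℝ u μ, (∀ s, ⇑(S s) =ᵐ[μ] fun ω => F ω * s (c ω)) ∧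
      ∀ s, ‖S s‖ ≤ (eLpNorm F u μ).toReal * ‖s‖ := by
  have hle (s : ι → ℝ) (ω : Ω) : ‖F ω * s (c ω)‖ ≤ ‖s‖ * ‖F ω‖ := by
    rw [norm_mul, mul_comm]
    gcongr
    exact norm_le_pi_norm s _
  have hmem (s : ι → ℝ) : MemLp (fun ω => F ω * s (c ω)) u μ :=
    hF.of_le_mul (hF.1.mul ((Measurable.of_discrete (f := s)).comp hc).aestronglyMeasurable)
      (ae_of_all _ (hle s))
  refine ⟨{ toFun := fun s => (hmem s).toLp, map_add' := ?_, map_smul' := ?_ }, ?_, ?_⟩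
  · intro s t
    rw [← MemLp.toLp_add]
    exact MemLp.toLp_congr _ _ (ae_of_all _ fun ω => mul_add _ _ _)
  · intro r s
    rw [RingHom.id_apply, ← MemLp.toLp_const_smul]
    exact MemLp.toLp_congr _ _ (ae_of_all _ fun ω => mul_left_comm _ _ _)
  · exact fun s => (hmem s).coeFn_toLp
  · intro s
    rw [← Lp.norm_toLp F hF, mul_comm]
    refine Lp.norm_le_mul_norm_of_ae_le_mul ?_
    filter_upwards [(hmem s).coeFn_toLp, hF.coeFn_toLp] with ω h1 h2
    rw [LinearMap.coe_mk, AddHom.coe_mk, h1, h2]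
    exact hle s ω

/-- A finite family in `L^u` is, up to a small error, the image of a family in a
finite-dimensional `ℓ^∞` space with controlled square function. -/
theorem exists_discretization [Fact (1 ≤ u)] (f : Fin n → Lp ℝ u μ) :
    ∃ (ι : Type) (_ : Fintype ι) (S : (ι → ℝ) →ₗ[ℝ] Lp ℝ u μ) (x : Fin n → ι → ℝ),
      (∀ s, ‖S s‖ ≤ (eLpNorm (squareFunction f) u μ).toReal * ‖s‖) ∧
      (∀ i, ∑ k, x k i ^ 2 ≤ 2 ^ 2) ∧
      ∀ k, ‖f k - S (x k)‖ ≤ ((n : ℝ) + 1)⁻¹ * (eLpNorm (squareFunction f) u μ).toReal := by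
  set F := squareFunction f with hFdef
  have hN : (0 : ℝ) < (n : ℝ) + 1 := by positivity
  have hf (k) : Measurable (f k) := (Lp.stronglyMeasurable (f k)).measurable
  have hF : Measurable F := measurable_squareFunction f
  set c : Ω → Fin n → ℤ := fun ω k => ⌊((n : ℝ) + 1) * (f k ω / F ω)⌋ with hc
  have hcm : Measurable c :=
    measurable_pi_iff.2 fun k => (((hf k).div hF).const_mul _).floor
  have hratio (k ω) : |f k ω / F ω| ≤ 1 := by
    rw [abs_div, abs_of_nonneg (squareFunction_nonneg f ω)]
    exact div_le_one_of_le₀ (abs_le_squareFunction f k ω) (squareFunction_nonneg f ω)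
  have hratio_sq (ω) : ∑ k, (f k ω / F ω) ^ 2 ≤ 1 := by
    simp only [div_pow]
    rw [← Finset.sum_div, ← squareFunction_sq]
    exact div_self_le_one _
  have herr (k ω) : |f k ω / F ω - c ω k / ((n : ℝ) + 1)| ≤ ((n : ℝ) + 1)⁻¹ := by
    have h1 := Int.floor_le (((n : ℝ) + 1) * (f k ω / F ω))
    have h2 := Int.lt_floor_add_one (((n : ℝ) + 1) * (f k ω / F ω))
    have e : f k ω / F ω - c ω k / ((n : ℝ) + 1) =
        (((n : ℝ) + 1) * (f k ω / F ω) - c ω k) * ((n : ℝ) + 1)⁻¹ := by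
      field_simp
    rw [e, abs_mul, abs_of_pos (inv_pos.2 hN)]
    refine mul_le_of_le_one_left (inv_pos.2 hN).le ?_
    rw [abs_le]
    constructor <;> simp only [hc] <;> linarith
  have hfin : (Set.range c).Finite := by
    refine (Set.finite_Icc (fun _ => -((n : ℤ) + 1)) (fun _ => (n : ℤ) + 1)).subset ?_
    rintro _ ⟨ω, rfl⟩
    refine ⟨fun k => ?_, fun k => ?_⟩
    · refine Int.le_floor.2 ?_
      push_cast
      nlinarith [(abs_le.1 (hratio k ω)).1]
    · have : (c ω k : ℝ) ≤ (n : ℝ) + 1 :=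
        (Int.floor_le _).trans (by nlinarith [(abs_le.1 (hratio k ω)).2])
      exact_mod_cast this
  let _ : Fintype (Set.range c) := hfin.fintype
  obtain ⟨S, hS, hSn⟩ := exists_linearMap_mul_comp (memLp_squareFunction f)
    (hcm.subtype_mk (h := fun ω => Set.mem_range_self ω))
  refine ⟨Set.range c, inferInstance, S, fun k i => (i.1 k : ℝ) / ((n : ℝ) + 1), hSn, ?_, ?_⟩
  · rintro ⟨_, ω, rfl⟩
    calc ∑ k, ((c ω k : ℝ) / ((n : ℝ) + 1)) ^ 2
        ≤ ∑ k, (2 * (f k ω / F ω) ^ 2 + 2 * ((n : ℝ) + 1)⁻¹ ^ 2) := by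
          gcongr with k
          have h := sq_le_sq.2 ((herr k ω).trans (le_abs_self _))
          nlinarith [sq_nonneg (2 * (f k ω / F ω) - c ω k / ((n : ℝ) + 1))]
      _ = 2 * ∑ k, (f k ω / F ω) ^ 2 + 2 * (n * ((n : ℝ) + 1)⁻¹ ^ 2) := by
          simp [Finset.sum_add_distrib, ← Finset.mul_sum]
          ring
      _ ≤ 2 * 1 + 2 * 1 := by
          gcongr
          · exact hratio_sq ω
          · rw [inv_pow, ← div_eq_mul_inv, div_le_one (by positivity)]
            nlinarith [(Nat.cast_nonneg n : (0 : ℝ) ≤ n)]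
      _ = 2 ^ 2 := by norm_num
  · intro k
    rw [← Lp.norm_toLp _ (memLp_squareFunction f)]
    refine Lp.norm_le_mul_norm_of_ae_le_mul ?_
    filter_upwards [hS fun i => (i.1 k : ℝ) / ((n : ℝ) + 1),
      (memLp_squareFunction f).coeFn_toLp,
      Lp.coeFn_sub (f k) (S fun i => (i.1 k : ℝ) / ((n : ℝ) + 1))] with ω h1 h2 h3
    have hfk : f k ω = F ω * (f k ω / F ω) := by
      rcases eq_or_ne (F ω) 0 with h0 | h0
      · have := abs_le_squareFunction f k ω
        rw [← hFdef, h0] at this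
        rw [h0, zero_mul]
        exact abs_nonpos_iff.1 this
      · field_simp
    rw [h3, Pi.sub_apply, h1, h2]
    change ‖f k ω - F ω * (c ω k / ((n : ℝ) + 1))‖ ≤ _
    conv_lhs => rw [hfk, ← mul_sub, norm_mul, mul_comm]
    gcongr
    exact herr k ω

theorem norm_le_eLpNorm_squareFunction [Fact (1 ≤ u)] (f : Fin n → Lp ℝ u μ) (k : Fin n) :
    ‖f k‖ ≤ (eLpNorm (squareFunction f) u μ).toReal := by
  rw [← Lp.norm_toLp _ (memLp_squareFunction f)]
  refine Lp.norm_le_norm_of_ae_le ?_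
  filter_upwards [(memLp_squareFunction f).coeFn_toLp] with ω h
  rw [h]
  exact (abs_le_squareFunction f k ω).trans (le_abs_self _)

theorem hasProjectiveBound_squareFunction {Ω' : Type*} [MeasurableSpace Ω'] {ν : Measure Ω'}
    {v : ℝ≥0∞} [Fact (1 ≤ u)] [Fact (1 ≤ v)] (f : Fin n → Lp ℝ u μ) (g : Fin n → Lp ℝ v ν) :
    HasProjectiveBound (∑ k, f k ⊗ₜ[ℝ] g k)
      (39 * (eLpNorm (squareFunction f) u μ).toReal *
        (eLpNorm (squareFunction g) v ν).toReal) := by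
  obtain ⟨ι, _, S, x, hS, hx, hfx⟩ := exists_discretization f
  obtain ⟨κ, _, T, y, hT, hy, hgy⟩ := exists_discretization g
  have hg := norm_le_eLpNorm_squareFunction g
  set A := (eLpNorm (squareFunction f) u μ).toReal
  set B := (eLpNorm (squareFunction g) v ν).toReal
  have hA : 0 ≤ A := toReal_nonneg
  have hB : 0 ≤ B := toReal_nonneg
  have hSx (k) : ‖S (x k)‖ ≤ A * 2 := by
    refine (hS _).trans ?_
    gcongr
    exact (pi_norm_le_iff_of_nonneg two_pos.le).2
      fun i => abs_le_of_sum_sq_le two_pos.le (hx i) k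
  have hn : (n : ℝ) * ((n : ℝ) + 1)⁻¹ ≤ 1 := by
    rw [← div_eq_mul_inv, div_le_one (by positivity)]
    linarith
  have h1 := (hasProjectiveBound_of_sum_sq_le x y two_pos two_pos hx hy).map hA hB S T hS hT
  have h2 : HasProjectiveBound (∑ k, (f k - S (x k)) ⊗ₜ[ℝ] g k) (A * B) := by
    refine HasProjectiveBound.of_sum _ _ ?_
    calc ∑ k, ‖f k - S (x k)‖ * ‖g k‖ ≤ ∑ k : Fin n, (((n : ℝ) + 1)⁻¹ * A) * B := by
          gcongr with k
          exacts [hfx k, hg k]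
      _ = (n * ((n : ℝ) + 1)⁻¹) * (A * B) := by simp; ring
      _ ≤ A * B := mul_le_of_le_one_left (by positivity) hn
  have h3 : HasProjectiveBound (∑ k, S (x k) ⊗ₜ[ℝ] (g k - T (y k))) (2 * (A * B)) := by
    refine HasProjectiveBound.of_sum _ _ ?_
    calc ∑ k, ‖S (x k)‖ * ‖g k - T (y k)‖ ≤ ∑ k : Fin n, (A * 2) * (((n : ℝ) + 1)⁻¹ * B) := by
          gcongr with k
          exacts [hSx k, hgy k]
      _ = (n * ((n : ℝ) + 1)⁻¹) * (2 * (A * B)) := by simp; ring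
      _ ≤ 2 * (A * B) := mul_le_of_le_one_left (by positivity) hn
  have hz : ∑ k, f k ⊗ₜ[ℝ] g k = TensorProduct.map S T (∑ k, x k ⊗ₜ[ℝ] y k) +
      ∑ k, (f k - S (x k)) ⊗ₜ[ℝ] g k + ∑ k, S (x k) ⊗ₜ[ℝ] (g k - T (y k)) := by
    simp only [map_sum, TensorProduct.map_tmul, ← Finset.sum_add_distrib,
      TensorProduct.sub_tmul, TensorProduct.tmul_sub]
    refine Finset.sum_congr rfl fun k _ => ?_
    abel
  rw [hz]
  exact ((h1.add h2).add h3).mono (le_of_eq (by ring))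

end SquareFunction

/-- Pre-dual form of Grothendieck's theorem for `L^p`-lattices: there is a
universal constant `K > 0` such that for all Lebesgue spaces, the projective
tensor seminorm of `z = ∑ᵢ fᵢ ⊗ gᵢ` is at most
`K ‖(∑ᵢ |fᵢ|²)^(1/2)‖_u ‖(∑ᵢ |gᵢ|²)^(1/2)‖_v`. -/
theorem stmt10 :
    ∃ K : ℝ, 0 < K ∧
      ∀ (Ω : Type*) (Ω' : Type*) [MeasurableSpace Ω] [MeasurableSpace Ω']
        (μ : Measure Ω) (ν : Measure Ω') (u v : ℝ≥0∞)
        [Fact (1 ≤ u)] [Fact (1 ≤ v)]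
        (n : ℕ) (f : Fin n → Lp ℝ u μ) (g : Fin n → Lp ℝ v ν),
        sInf {c : ℝ | ∃ (m : ℕ) (x : Fin m → Lp ℝ u μ) (y : Fin m → Lp ℝ v ν),
            (∑ i, x i ⊗ₜ[ℝ] y i) = (∑ i, f i ⊗ₜ[ℝ] g i) ∧
              c = ∑ i, ‖x i‖ * ‖y i‖} ≤
          K * (eLpNorm (fun ω => (∑ i, |f i ω| ^ (2 : ℝ)) ^ (1 / (2 : ℝ))) u μ).toReal *
            (eLpNorm (fun ω' => (∑ i, |g i ω'| ^ (2 : ℝ)) ^ (1 / (2 : ℝ))) v ν).toReal := by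
  exact ⟨39, by norm_num, fun _ _ _ _ _ _ _ _ _ _ _ f g =>
    (hasProjectiveBound_squareFunction f g).sInf_le⟩
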